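/- (Correctness of error-matrix sampling.) Let d, n, b ≥ 1, W ∈ ℝ^{d×n}, X' ∈ ℝ^{d×b}, let D ∈ ℝ^{b×n} be a matrix each of whose rows sums to zero, and let v ∈ ℝ^b be arbitrary. For 1 ≤ k ≤ b let x'^{(k)} be the k-th column of X' and d^{(k)} ∈ ℝ^n the k-th row of D, and define y'^{(k)} = v_k·softmax(Wᵀ x'^{(k)}) − d^{(k)}. Then ∑_{j=1}^n y'^{(k)}_j = v_k for every k, and the mini-batch B' = (x'^{(1)}, y'^{(1)}), …, (x'^{(b)}, y'^{(b)}) satisfies ∇_W L(B') = (1/b)·X'·D. -/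

import Mathlib

open scoped BigOperators

/-- `softmax z i = exp (z i) / ∑ j, exp (z j)`. -/
noncomputable def softmax {n : ℕ} (z : Fin n → ℝ) : Fin n → ℝ :=
  fun i => Real.exp (z i) / ∑ j, Real.exp (z j)

/-- Cross-entropy loss `ℓ(ŷ, y) = -∑ i, y i * log (ŷ i)`. -/
noncomputable def xent {n : ℕ} (yhat y : Fin n → ℝ) : ℝ :=
  -∑ i, y i * Real.log (yhat i)

/-- `tmulVec W x = Wᵀ x`, i.e. `(tmulVec W x) j = ∑ m, W m j * x m`. -/
def tmulVec {d n : ℕ} (W : Fin d → Fin n → ℝ) (x : Fin d → ℝ) : Fin n → ℝ :=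
  fun j => ∑ m, W m j * x m

/-- Batch cross-entropy loss `L(B; W) = (1/b) ∑ k, ℓ(softmax (Wᵀ x⁽ᵏ⁾), y⁽ᵏ⁾)`. -/
noncomputable def batchLoss {d n b : ℕ} (W : Fin d → Fin n → ℝ)
    (X : Fin b → Fin d → ℝ) (Y : Fin b → Fin n → ℝ) : ℝ :=
  (1 / (b : ℝ)) * ∑ k, xent (softmax (tmulVec W (X k))) (Y k)

/-- The gradient matrix `∇_W L(B)` of the batch loss, whose `(i, j)` entry is the
Fréchet derivative of the batch loss at `W` in the direction of the standard basis
matrix `E_{ij}`. -/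
noncomputable def gradW {d n b : ℕ} (W : Fin d → Fin n → ℝ)
    (X : Fin b → Fin d → ℝ) (Y : Fin b → Fin n → ℝ) : Matrix (Fin d) (Fin n) ℝ :=
  Matrix.of fun i j =>
    fderiv ℝ (fun W' => batchLoss W' X Y) W (Pi.single i (Pi.single j (1 : ℝ)))

lemma xent_softmax_eq {n : ℕ} (hn : 1 ≤ n) (z y : Fin n → ℝ) :
    xent (softmax z) y = (∑ j, y j) * Real.log (∑ j, Real.exp (z j)) - ∑ j, y j * z j := by
  haveI : Nonempty (Fin n) := ⟨⟨0, hn⟩⟩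
  have hS : (∑ j, Real.exp (z j)) ≠ 0 :=
    (Finset.sum_pos (fun j _ => Real.exp_pos _) Finset.univ_nonempty).ne'
  unfold xent softmax
  simp_rw [Real.log_div (Real.exp_ne_zero _) hS, Real.log_exp, mul_sub]
  rw [Finset.sum_sub_distrib, Finset.sum_mul]
  ring

/-- The linear map `W ↦ (Wᵀ x) j`. -/
noncomputable def tmulCLM {d n : ℕ} (x : Fin d → ℝ) (j : Fin n) :
    (Fin d → Fin n → ℝ) →L[ℝ] ℝ :=
  ∑ m, x m • ((ContinuousLinearMap.proj (R := ℝ) (φ := fun _ : Fin n => ℝ) j).comp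
    (ContinuousLinearMap.proj (R := ℝ) (φ := fun _ : Fin d => Fin n → ℝ) m))

lemma tmulCLM_apply {d n : ℕ} (x : Fin d → ℝ) (j : Fin n) (W : Fin d → Fin n → ℝ) :
    tmulCLM x j W = tmulVec W x j := by
  simp [tmulCLM, tmulVec, ContinuousLinearMap.sum_apply, mul_comm]

lemma tmulCLM_single {d n : ℕ} (x : Fin d → ℝ) (j i : Fin n) (m : Fin d) :
    tmulCLM x j (Pi.single m (Pi.single i (1 : ℝ))) = if j = i then x m else 0 := by
  rw [tmulCLM_apply]
  unfold tmulVec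
  rw [Finset.sum_eq_single m]
  · simp [Pi.single_apply]
  · intro k _ hk
    simp [Pi.single_eq_of_ne hk]
  · simp

lemma batchLoss_hasFDerivAt {d n b : ℕ} (hn : 1 ≤ n) (W : Fin d → Fin n → ℝ)
    (X : Fin b → Fin d → ℝ) (Y : Fin b → Fin n → ℝ) :
    HasFDerivAt (fun W' => batchLoss W' X Y)
      ((1 / (b : ℝ)) • ∑ k, ((∑ j, Y k j) • ((∑ j, Real.exp (tmulCLM (X k) j W))⁻¹ •
        ∑ j, Real.exp (tmulCLM (X k) j W) • tmulCLM (X k) j) -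
        ∑ j, Y k j • tmulCLM (X k) j)) W := by
  haveI : Nonempty (Fin n) := ⟨⟨0, hn⟩⟩
  have e : (fun W' : Fin d → Fin n → ℝ => batchLoss W' X Y) = fun W' =>
      (1 / (b : ℝ)) * ∑ k, ((∑ j, Y k j) * Real.log (∑ j, Real.exp (tmulCLM (X k) j W')) -
        ∑ j, Y k j * tmulCLM (X k) j W') := by
    funext W'
    simp only [batchLoss, xent_softmax_eq hn, tmulCLM_apply]
  rw [e]
  refine HasFDerivAt.const_mul (HasFDerivAt.fun_sum fun k _ => HasFDerivAt.sub ?_ ?_) _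
  · refine HasFDerivAt.const_mul (HasFDerivAt.log (HasFDerivAt.fun_sum fun j _ => ?_) ?_) _
    · exact (tmulCLM (X k) j).hasFDerivAt.exp
    · exact (Finset.sum_pos (fun j _ => Real.exp_pos _) Finset.univ_nonempty).ne'
  · exact HasFDerivAt.fun_sum fun j _ => (tmulCLM (X k) j).hasFDerivAt.const_mul _

/-- Correctness of error-matrix sampling: if each row of `D ∈ ℝ^{b×n}` sums to zero
and `y'⁽ᵏ⁾ = v k • softmax (Wᵀ x'⁽ᵏ⁾) - d⁽ᵏ⁾`, then `∑ j, y'⁽ᵏ⁾ j = v k` for every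
`k`, and the mini-batch `B' = (x'⁽ᵏ⁾, y'⁽ᵏ⁾)ₖ` has batch-loss gradient
`∇_W L(B') = (1/b)·X'·D`: the batch loss is differentiable at `W` and each entry of
its gradient matrix equals `(1/b) ∑ k, X' k m * D k j`. -/
theorem error_matrix_sampling_correct (d n b : ℕ) (hd : 1 ≤ d) (hn : 1 ≤ n)
    (hb : 1 ≤ b) (W : Fin d → Fin n → ℝ) (X' : Fin b → Fin d → ℝ)
    (D : Fin b → Fin n → ℝ) (hD : ∀ k, ∑ j, D k j = 0)
    (v : Fin b → ℝ) (Y' : Fin b → Fin n → ℝ)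
    (hY' : ∀ k j, Y' k j = v k * softmax (tmulVec W (X' k)) j - D k j) :
    (∀ k, ∑ j, Y' k j = v k) ∧
    DifferentiableAt ℝ (fun W'' => batchLoss W'' X' Y') W ∧
    (∀ m j, gradW W X' Y' m j = (1 / (b : ℝ)) * ∑ k, X' k m * D k j) := by
  haveI : Nonempty (Fin n) := ⟨⟨0, hn⟩⟩
  have hsum : ∀ k, ∑ j, Y' k j = v k := by
    intro k
    have hS : (∑ j, Real.exp (tmulVec W (X' k) j)) ≠ 0 :=
      (Finset.sum_pos (fun j _ => Real.exp_pos _) Finset.univ_nonempty).ne'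
    simp_rw [hY', Finset.sum_sub_distrib, hD, ← Finset.mul_sum, softmax, ← Finset.sum_div]
    rw [div_self hS]
    ring
  have hder := batchLoss_hasFDerivAt hn W X' Y'
  refine ⟨hsum, hder.differentiableAt, fun m j => ?_⟩
  simp only [gradW, Matrix.of_apply]
  rw [hder.fderiv]
  simp only [ContinuousLinearMap.smul_apply, ContinuousLinearMap.sum_apply,
    ContinuousLinearMap.sub_apply, tmulCLM_single, smul_eq_mul, hsum, mul_ite, mul_zero,
    Finset.sum_ite_eq', Finset.mem_univ, if_true]
  congr 1
  refine Finset.sum_congr rfl fun k _ => ?_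
  rw [hY']
  simp only [softmax, tmulCLM_apply]
  ring
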